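/- arXiv:2305.18699 — 3 statements merged into one kernel-verified Lean document; each statement's English description precedes it below -/
import Mathlib

section
/- For any d ≥ 1 and any θ, θ' ∈ ℝ^d, it holds that ‖Softmax(θ) − Softmax(θ')‖₁ ≤ 2‖θ − θ'‖_∞. -/
/-- Softmax of a vector in ℝ^n: `softmax x i = exp (x i) / ∑ j, exp (x j)`. -/
noncomputable def softmax {n : ℕ} (x : Fin n → ℝ) : Fin n → ℝ :=
  fun i => Real.exp (x i) / ∑ j, Real.exp (x j)

/-- The logarithmic mean is at most the arithmetic mean (for ordered arguments). -/
theorem sub_le_log_sub_log_mul_of_le {a b : ℝ} (hb : 0 < b) (hab : b ≤ a) :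
    a - b ≤ (Real.log a - Real.log b) * ((a + b) / 2) := by
  have ha : 0 < a := hb.trans_le hab
  have h := Real.le_log_one_add_of_nonneg (x := (a - b) / b)
    (div_nonneg (sub_nonneg.2 hab) hb.le)
  have h1 : 1 + (a - b) / b = a / b := by field_simp; ring
  have h2 : 2 * ((a - b) / b) / ((a - b) / b + 2) = (a - b) / ((a + b) / 2) := by
    have h3 : (a - b) / b + 2 = (a + b) / b := by field_simp; ring
    rw [h3]
    field_simp
  rw [h1, h2, Real.log_div ha.ne' hb.ne', div_le_iff₀ (by positivity)] at h
  exact h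

/-- The logarithmic mean is at most the arithmetic mean. -/
theorem abs_sub_le_abs_log_sub_log_mul {a b : ℝ} (ha : 0 < a) (hb : 0 < b) :
    |a - b| ≤ |Real.log a - Real.log b| * ((a + b) / 2) := by
  wlog hab : b ≤ a generalizing a b
  · rw [abs_sub_comm a, abs_sub_comm (Real.log a), add_comm a]
    exact this hb ha (le_of_not_ge hab)
  rw [abs_of_nonneg (sub_nonneg.2 hab)]
  exact (sub_le_log_sub_log_mul_of_le hb hab).trans
    (mul_le_mul_of_nonneg_right (le_abs_self _) (by positivity))

theorem sum_exp_pos {n : ℕ} [NeZero n] (x : Fin n → ℝ) : 0 < ∑ j, Real.exp (x j) :=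
  Finset.sum_pos (fun _ _ => Real.exp_pos _) Finset.univ_nonempty

theorem softmax_pos {n : ℕ} [NeZero n] (x : Fin n → ℝ) (i : Fin n) : 0 < softmax x i :=
  div_pos (Real.exp_pos _) (sum_exp_pos x)

theorem sum_softmax {n : ℕ} [NeZero n] (x : Fin n → ℝ) : ∑ i, softmax x i = 1 := by
  simp only [softmax]
  rw [← Finset.sum_div, div_self (sum_exp_pos x).ne']

theorem log_softmax {n : ℕ} [NeZero n] (x : Fin n → ℝ) (i : Fin n) :
    Real.log (softmax x i) = x i - Real.log (∑ j, Real.exp (x j)) := by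
  rw [softmax, Real.log_div (Real.exp_pos _).ne' (sum_exp_pos x).ne', Real.log_exp]

theorem log_sum_exp_le_add {n : ℕ} [NeZero n] {x y : Fin n → ℝ} {c : ℝ}
    (h : ∀ i, x i ≤ c + y i) :
    Real.log (∑ j, Real.exp (x j)) ≤ c + Real.log (∑ j, Real.exp (y j)) := by
  rw [← Real.log_exp c, ← Real.log_mul (Real.exp_pos c).ne' (sum_exp_pos y).ne',
    Finset.mul_sum]
  refine Real.log_le_log (sum_exp_pos x) (Finset.sum_le_sum fun i _ => ?_)
  rw [← Real.exp_add]
  exact Real.exp_le_exp.2 (h i)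

theorem abs_log_softmax_sub_le {n : ℕ} [NeZero n] {x y : Fin n → ℝ} {c : ℝ}
    (h : ∀ i, |x i - y i| ≤ c) (i : Fin n) :
    |Real.log (softmax x i) - Real.log (softmax y i)| ≤ 2 * c := by
  have hxy := log_sum_exp_le_add (x := x) (y := y) (c := c)
    fun j => by linarith [(abs_le.1 (h j)).2]
  have hyx := log_sum_exp_le_add (x := y) (y := x) (c := c)
    fun j => by linarith [(abs_le.1 (h j)).1]
  obtain ⟨h1, h2⟩ := abs_le.1 (h i)
  rw [log_softmax, log_softmax, abs_le]
  constructor <;> linarith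

/-- `‖Softmax(θ) − Softmax(θ')‖₁ ≤ 2 ‖θ − θ'‖_∞`. -/
theorem softmax_lipschitz (d : ℕ) (hd : 1 ≤ d) (θ θ' : Fin d → ℝ) :
    ∑ i, |softmax θ i - softmax θ' i| ≤ 2 * ⨆ i, |θ i - θ' i| := by
  have : NeZero d := ⟨by omega⟩
  have h : ∀ i, |θ i - θ' i| ≤ ⨆ i, |θ i - θ' i| :=
    le_ciSup (Set.finite_range fun i => |θ i - θ' i|).bddAbove
  calc ∑ i, |softmax θ i - softmax θ' i|
      ≤ ∑ i, (2 * ⨆ i, |θ i - θ' i|) * ((softmax θ i + softmax θ' i) / 2) := by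
        refine Finset.sum_le_sum fun i _ => ?_
        have hp := softmax_pos θ i
        have hq := softmax_pos θ' i
        exact (abs_sub_le_abs_log_sub_log_mul hp hq).trans
          (mul_le_mul_of_nonneg_right (abs_log_softmax_sub_le h i) (by positivity))
    _ = 2 * ⨆ i, |θ i - θ' i| := by
        rw [← Finset.mul_sum, ← Finset.sum_div, Finset.sum_add_distrib, sum_softmax, sum_softmax]
        ring
end

section
/- For any integer l ≥ 1, any ε > 0, and any integer d ≥ 4·log(2l)/ε², there exist vectors u_1, …, u_l ∈ ℝ^d such that ⟨u_i, u_i⟩ = 1 for all i ∈ [l] and |⟨u_i, u_j⟩| ≤ ε for all i ≠ j. -/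
/-- Moment generating function bound for the inner product of a fixed sign vector with a
uniformly random one. -/
lemma sum_exp_mul_inner_signs_le {κ : Type*} [Fintype κ] [DecidableEq κ] (t : ℝ) (y : κ → ℝ)
    (hy : ∀ k, y k = 1 ∨ y k = -1) :
    ∑ x ∈ Fintype.piFinset fun _ : κ => ({1, -1} : Finset ℝ), Real.exp (t * ∑ k, x k * y k) ≤
      2 ^ Fintype.card κ * Real.exp (Fintype.card κ * (t ^ 2 / 2)) := by
  have hne : (1 : ℝ) ≠ -1 := by norm_num
  calc ∑ x ∈ Fintype.piFinset fun _ : κ => ({1, -1} : Finset ℝ), Real.exp (t * ∑ k, x k * y k)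
      = ∏ k, ∑ a ∈ ({1, -1} : Finset ℝ), Real.exp (t * (a * y k)) := by
        rw [Finset.prod_univ_sum]
        exact Finset.sum_congr rfl fun x _ => by rw [Finset.mul_sum, Real.exp_sum]
    _ = ∏ _k : κ, 2 * Real.cosh t := by
        refine Finset.prod_congr rfl fun k _ => ?_
        rw [Finset.sum_pair hne, Real.cosh_eq]
        rcases hy k with h | h <;> simp [h] <;> ring
    _ = 2 ^ Fintype.card κ * Real.cosh t ^ Fintype.card κ := by
        rw [Finset.prod_const, Finset.card_univ, mul_pow]
    _ ≤ 2 ^ Fintype.card κ * Real.exp (Fintype.card κ * (t ^ 2 / 2)) := by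
        rw [Real.exp_nat_mul]
        have := (Real.cosh_pos t).le
        gcongr
        exact Real.cosh_le_exp_half_sq t

/-- A family of fewer than `exp (n ε² / 2) / 2` sign vectors in dimension `n` admits a sign vector
whose inner product with every member is at most `ε n` in absolute value. -/
lemma exists_sign_vector_abs_inner_le {ι κ : Type*} [Fintype ι] [Fintype κ] {ε : ℝ}
    (hε : 0 < ε) (y : ι → κ → ℝ) (hy : ∀ i k, y i k = 1 ∨ y i k = -1)
    (hcard : 2 * (Fintype.card ι : ℝ) < Real.exp (Fintype.card κ * (ε ^ 2 / 2))) :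
    ∃ x : κ → ℝ, (∀ k, x k = 1 ∨ x k = -1) ∧
      ∀ i, |∑ k, x k * y i k| ≤ ε * Fintype.card κ := by
  classical
  by_contra! hbad
  set S := Fintype.piFinset fun _ : κ => ({1, -1} : Finset ℝ) with hS
  set E := Real.exp (Fintype.card κ * (ε ^ 2 / 2)) with hE
  have hEpos : 0 < E := Real.exp_pos _
  have hScard : (S.card : ℝ) = 2 ^ Fintype.card κ := by
    have hne : (1 : ℝ) ≠ -1 := by norm_num
    simp [hS, Fintype.card_piFinset, Finset.card_pair hne]
  have hlower : ∀ x ∈ S, E * E ≤ ∑ i, (Real.exp (ε * ∑ k, x k * y i k) +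
      Real.exp (-ε * ∑ k, x k * y i k)) := by
    intro x hx
    obtain ⟨i, hi⟩ := hbad x fun k => by simpa using Fintype.mem_piFinset.mp hx k
    refine le_trans ?_ (Finset.single_le_sum (fun j _ => by positivity) (Finset.mem_univ i))
    have hexp : E * E = Real.exp (ε * (ε * Fintype.card κ)) := by
      rw [hE, ← Real.exp_add]; ring_nf
    rw [hexp]
    rcases lt_abs.mp hi with h | h
    · exact (Real.exp_le_exp.mpr (by gcongr)).trans
        (le_add_of_nonneg_right (Real.exp_pos _).le)
    · refine (Real.exp_le_exp.mpr ?_).trans (le_add_of_nonneg_left (Real.exp_pos _).le)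
      rw [neg_mul, ← mul_neg]
      gcongr
  have hsum := Finset.sum_le_sum hlower
  have hupper : ∑ x ∈ S, ∑ i, (Real.exp (ε * ∑ k, x k * y i k) +
      Real.exp (-ε * ∑ k, x k * y i k)) ≤ Fintype.card ι * (2 * (2 ^ Fintype.card κ * E)) := by
    rw [Finset.sum_comm, ← nsmul_eq_mul]
    refine Finset.sum_le_card_nsmul _ _ _ fun i _ => ?_
    rw [Finset.sum_add_distrib, two_mul]
    have h₁ := sum_exp_mul_inner_signs_le ε (y i) (hy i)
    have h₂ := sum_exp_mul_inner_signs_le (-ε) (y i) (hy i)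
    rw [neg_sq] at h₂
    exact add_le_add h₁ h₂
  rw [Finset.sum_const, nsmul_eq_mul, hScard] at hsum
  have hlt : 2 * (Fintype.card ι : ℝ) * (2 ^ Fintype.card κ * E) < E * (2 ^ Fintype.card κ * E) :=
    mul_lt_mul_of_pos_right hcard (by positivity)
  linarith

/-- There are `m` sign vectors in dimension `d` with pairwise inner products at most `ε d` in
absolute value, as soon as `2 m ≤ exp (d ε² / 2)`. -/
lemma exists_sign_vectors_pairwise_abs_inner_le {ε : ℝ} (hε : 0 < ε) (d m : ℕ)
    (hm : 2 * (m : ℝ) ≤ Real.exp (d * (ε ^ 2 / 2))) :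
    ∃ s : Fin m → Fin d → ℝ, (∀ i k, s i k = 1 ∨ s i k = -1) ∧
      ∀ i j, i ≠ j → |∑ k, s i k * s j k| ≤ ε * d := by
  induction m with
  | zero => exact ⟨Fin.elim0, fun i => i.elim0, fun i => i.elim0⟩
  | succ m ih =>
    push_cast at hm
    obtain ⟨s, hs, hinner⟩ := ih (by linarith)
    obtain ⟨x, hx, hxs⟩ := exists_sign_vector_abs_inner_le hε s hs
      (by simp only [Fintype.card_fin]; linarith)
    simp only [Fintype.card_fin] at hxs
    refine ⟨Fin.cons x s, fun i => ?_, fun i j hij => ?_⟩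
    · cases i using Fin.cases with
      | zero => exact hx
      | succ i => exact hs i
    · cases i using Fin.cases with
      | zero =>
        cases j using Fin.cases with
        | zero => exact absurd rfl hij
        | succ j => exact hxs j
      | succ i =>
        cases j using Fin.cases with
        | zero => simpa [mul_comm] using hxs i
        | succ j => exact hinner i j fun h => hij (congrArg Fin.succ h)

/-- For any `l ≥ 1`, `ε > 0` and `d ≥ 4 log(2l)/ε²`, there exist `ε`-approximately
orthonormal vectors `u_1, …, u_l ∈ ℝ^d`: each has unit inner product with itself and
`|⟨u_i, u_j⟩| ≤ ε` for `i ≠ j`. -/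
theorem exists_approximately_orthonormal (l : ℕ) (hl : 1 ≤ l) (ε : ℝ) (hε : 0 < ε)
    (d : ℕ) (hd : 4 * Real.log (2 * l) / ε ^ 2 ≤ (d : ℝ)) :
    ∃ u : Fin l → Fin d → ℝ,
      (∀ i, ∑ k, u i k * u i k = 1) ∧
      (∀ i j, i ≠ j → |∑ k, u i k * u j k| ≤ ε) := by
  have hl' : (1 : ℝ) ≤ l := by exact_mod_cast hl
  have hlog : 0 < Real.log (2 * l) := Real.log_pos (by linarith)
  have hdpos : (0 : ℝ) < d := lt_of_lt_of_le (by positivity) hd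
  rw [div_le_iff₀ (by positivity)] at hd
  obtain ⟨s, hs, hinner⟩ := exists_sign_vectors_pairwise_abs_inner_le hε d l
    ((Real.log_le_iff_le_exp (by positivity)).mp (by linarith))
  have hscale : ∀ i j, ∑ k, s i k / √d * (s j k / √d) = (∑ k, s i k * s j k) / d := by
    intro i j
    simp_rw [div_mul_div_comm, Real.mul_self_sqrt hdpos.le, ← Finset.sum_div]
  refine ⟨fun i k => s i k / √d, fun i => ?_, fun i j hij => ?_⟩
  · have hsq : ∀ k, s i k * s i k = 1 := fun k => mul_self_eq_one_iff.mpr (hs i k)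
    simp [hscale, hsq, hdpos.ne']
  · rw [hscale, abs_div, abs_of_pos hdpos, div_le_iff₀ hdpos]
    exact hinner i j hij
end

section
/- For every integer U ≥ 1, setting φ = 2π/(2U+1), the following hold: (i) 1 − cos(φ) ≥ 1/U², and (ii) for every integer k that is not divisible by 2U+1, cos(kφ) ≤ cos(φ). Consequently, for every such k, cos(0·φ) − cos(kφ) ≥ 1/U². -/
/-- On `[x, 2π - x]` with `0 ≤ x`, the cosine is at most its value at the endpoints. -/
theorem cos_le_cos_of_le_of_le_two_pi_sub {x y : ℝ} (hx : 0 ≤ x) (hxy : x ≤ y)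
    (hy : y ≤ 2 * Real.pi - x) : Real.cos y ≤ Real.cos x := by
  have hsum : 0 ≤ Real.sin ((y + x) / 2) :=
    Real.sin_nonneg_of_nonneg_of_le_pi (by linarith) (by linarith)
  have hdiff : 0 ≤ Real.sin ((y - x) / 2) :=
    Real.sin_nonneg_of_nonneg_of_le_pi (by linarith) (by linarith)
  have hcos := Real.cos_sub_cos y x
  nlinarith [mul_nonneg hsum hdiff]

/-- Among the multiples of `2π/n` by integers not divisible by `n`, the cosine is largest
at `2π/n` itself. -/
theorem cos_int_mul_two_pi_div_le {n k : ℤ} (hn : 0 < n) (hk : ¬ n ∣ k) :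
    Real.cos (k * (2 * Real.pi / n)) ≤ Real.cos (2 * Real.pi / n) := by
  have hn' : (0 : ℝ) < n := by exact_mod_cast hn
  have hr_pos : 1 ≤ k % n := by
    have := Int.emod_nonneg k hn.ne'
    have : k % n ≠ 0 := fun h => hk (Int.dvd_of_emod_eq_zero h)
    omega
  have hr_lt : k % n + 1 ≤ n := Int.emod_lt_of_pos k hn
  have hr_pos' : (1 : ℝ) ≤ (k % n : ℤ) := by exact_mod_cast hr_pos
  have hr_lt' : ((k % n : ℤ) : ℝ) + 1 ≤ n := by exact_mod_cast hr_lt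
  have hk_eq : (k : ℝ) = (k % n : ℤ) + n * (k / n : ℤ) := by
    exact_mod_cast (Int.emod_add_mul_ediv k n).symm
  have hangle : (k : ℝ) * (2 * Real.pi / n)
      = (k % n : ℤ) * (2 * Real.pi / n) + (k / n : ℤ) * (2 * Real.pi) := by
    rw [hk_eq]
    field_simp
  have hstep : 0 ≤ 2 * Real.pi / (n : ℝ) := by positivity
  have hfull : (n : ℝ) * (2 * Real.pi / n) = 2 * Real.pi := by field_simp
  rw [hangle, Real.cos_add_int_mul_two_pi]
  apply cos_le_cos_of_le_of_le_two_pi_sub hstep <;> nlinarith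

/-- The gap `1 - cos (2π/(2U+1))` is at least `1/U²`. -/
theorem one_div_sq_le_one_sub_cos {U : ℕ} (hU : 1 ≤ U) :
    1 / (U : ℝ) ^ 2 ≤ 1 - Real.cos (2 * Real.pi / (2 * (U : ℝ) + 1)) := by
  obtain rfl | hU2 := hU.eq_or_lt
  · have hangle : 2 * Real.pi / (2 * ((1 : ℕ) : ℝ) + 1) = Real.pi - Real.pi / 3 := by
      push_cast
      ring
    rw [hangle, Real.cos_pi_sub, Real.cos_pi_div_three]
    norm_num
  · have hU' : (2 : ℝ) ≤ U := by exact_mod_cast hU2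
    have hle : |2 * Real.pi / (2 * (U : ℝ) + 1)| ≤ Real.pi := by
      rw [abs_of_nonneg (by positivity), div_le_iff₀ (by positivity)]
      nlinarith [Real.pi_pos]
    have hcos := Real.cos_le_one_sub_mul_cos_sq hle
    have hsq : 2 / Real.pi ^ 2 * (2 * Real.pi / (2 * (U : ℝ) + 1)) ^ 2
        = 8 / (2 * (U : ℝ) + 1) ^ 2 := by
      field_simp
      norm_num
    have hbound : 1 / (U : ℝ) ^ 2 ≤ 8 / (2 * (U : ℝ) + 1) ^ 2 := by
      rw [div_le_div_iff₀ (by positivity) (by positivity)]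
      nlinarith
    linarith


/-- For `U ≥ 1` and `φ = 2π/(2U+1)`: (i) `1 − cos φ ≥ 1/U²`; (ii) for every integer `k`
not divisible by `2U+1`, `cos(kφ) ≤ cos φ`; consequently, for every such `k`,
`cos(0·φ) − cos(kφ) ≥ 1/U²`. -/
theorem positional_encoding_gap (U : ℕ) (hU : 1 ≤ U) (φ : ℝ)
    (hφ : φ = 2 * Real.pi / (2 * (U : ℝ) + 1)) :
    (1 : ℝ) / (U : ℝ) ^ 2 ≤ 1 - Real.cos φ ∧
    (∀ k : ℤ, ¬ ((2 * (U : ℤ) + 1) ∣ k) → Real.cos ((k : ℝ) * φ) ≤ Real.cos φ) ∧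
    (∀ k : ℤ, ¬ ((2 * (U : ℤ) + 1) ∣ k) →
      (1 : ℝ) / (U : ℝ) ^ 2 ≤ Real.cos (((0 : ℤ) : ℝ) * φ) - Real.cos ((k : ℝ) * φ)) := by
  subst hφ
  have hgap := one_div_sq_le_one_sub_cos hU
  have hmax : ∀ k : ℤ, ¬ ((2 * (U : ℤ) + 1) ∣ k) →
      Real.cos (k * (2 * Real.pi / (2 * (U : ℝ) + 1)))
        ≤ Real.cos (2 * Real.pi / (2 * (U : ℝ) + 1)) := by
    intro k hk
    simpa using cos_int_mul_two_pi_div_le (by positivity) hk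
  refine ⟨hgap, hmax, fun k hk => ?_⟩
  rw [Int.cast_zero, zero_mul, Real.cos_zero]
  linarith [hmax k hk]
end
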